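/- Let V be a ℤ^d-valued random vector and let U be uniformly distributed on the hypercube [0,1)^d and independent of V. Then V + U has a density, and its differential entropy equals the discrete entropy of V: h(V + U) = H(V). -/

import Mathlib

open MeasureTheory ProbabilityTheory Real Filter Topology
open scoped ENNReal

/-- Componentwise integer part of a vector in ℝ^d. -/
noncomputable def intFloor (d : ℕ) (x : Fin d → ℝ) : Fin d → ℤ := fun i => ⌊x i⌋

/-- Discrete (Shannon) entropy, in nats, of the random element `V` under `P`,
valued in `[0,∞]`. -/
noncomputable def discEnt {Ω α : Type*} [MeasurableSpace Ω] (P : Measure Ω) (V : Ω → α) : ℝ≥0∞ :=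
  ∑' a : α, ENNReal.ofReal (Real.negMulLog (P (V ⁻¹' {a})).toReal)

/-- Differential entropy of a measure on ℝ^d (w.r.t. Lebesgue measure),
as a Bochner integral of `-f log f` where `f` is the Radon–Nikodym density. -/
noncomputable def diffEnt {d : ℕ} (μ : Measure (Fin d → ℝ)) : ℝ :=
  -∫ x, ((μ.rnDeriv volume x).toReal) * Real.log ((μ.rnDeriv volume x).toReal)

open Classical in
/-- Kullback–Leibler divergence of `μ` w.r.t. `ν`, valued in `[0,∞]`. -/
noncomputable def klDiv {α : Type*} [MeasurableSpace α] (μ ν : Measure α) : ℝ≥0∞ :=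
  if μ ≪ ν ∧ Integrable (llr μ ν) μ then ENNReal.ofReal (∫ x, llr μ ν x ∂μ) else ⊤

theorem measurable_intFloor (d : ℕ) : Measurable (intFloor d) :=
  measurable_pi_lambda _ fun i => Int.measurable_floor.comp (measurable_pi_apply i)

/-- Translating by an integer vector `a` maps the unit cube onto the fiber of `intFloor` at `a`. -/
theorem intFloor_intCast_add_eq_iff {d : ℕ} (a : Fin d → ℤ) (x : Fin d → ℝ) :
    intFloor d ((fun i => (a i : ℝ)) + x) = a ↔ ∀ i, 0 ≤ x i ∧ x i < 1 := by
  simp [funext_iff, intFloor, Int.floor_eq_zero_iff]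

theorem volume_unitCube (d : ℕ) : volume {x : Fin d → ℝ | ∀ i, 0 ≤ x i ∧ x i < 1} = 1 := by
  have h : {x : Fin d → ℝ | ∀ i, 0 ≤ x i ∧ x i < 1} = Set.univ.pi fun _ => Set.Ico 0 1 := by
    ext x
    simp
  rw [h, volume_pi_pi]
  simp

theorem volume_inter_intFloor_fiber {d : ℕ} (a : Fin d → ℤ) (s : Set (Fin d → ℝ)) :
    volume (s ∩ intFloor d ⁻¹' {a}) =
      volume (((fun i => (a i : ℝ)) + ·) ⁻¹' s ∩ {x : Fin d → ℝ | ∀ i, 0 ≤ x i ∧ x i < 1}) := by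
  rw [← measure_preimage_add volume (fun i => (a i : ℝ)) (s ∩ intFloor d ⁻¹' {a})]
  congr 1
  ext x
  simp only [Set.mem_preimage, Set.mem_inter_iff, Set.mem_singleton_iff, Set.mem_ofPred_eq,
    intFloor_intCast_add_eq_iff]

theorem map_intFloor_volume (d : ℕ) :
    Measure.map (intFloor d) volume = Measure.count := by
  refine Measure.ext_of_singleton fun a => ?_
  rw [Measure.map_apply (measurable_intFloor d) (measurableSet_singleton a),
    Measure.count_singleton, ← Set.univ_inter (intFloor d ⁻¹' {a}), volume_inter_intFloor_fiber]
  simpa using volume_unitCube d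

theorem lintegral_comp_intFloor {d : ℕ} (g : (Fin d → ℤ) → ℝ≥0∞) :
    ∫⁻ x, g (intFloor d x) = ∑' a, g a := by
  rw [← lintegral_map (measurable_of_countable g) (measurable_intFloor d), map_intFloor_volume,
    lintegral_count]

theorem setLIntegral_comp_intFloor {d : ℕ} (g : (Fin d → ℤ) → ℝ≥0∞) (s : Set (Fin d → ℝ)) :
    ∫⁻ x in s, g (intFloor d x) = ∑' a, g a * volume (s ∩ intFloor d ⁻¹' {a}) := by
  rw [← lintegral_map (measurable_of_countable g) (measurable_intFloor d), lintegral_countable']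
  refine tsum_congr fun a => ?_
  rw [Measure.map_apply (measurable_intFloor d) (measurableSet_singleton a),
    Measure.restrict_apply (measurable_intFloor d (measurableSet_singleton a)), Set.inter_comm]

/-- The law of `V + U` has density `x ↦ P(V = ⌊x⌋)`. -/
theorem map_int_add_uniform_eq_withDensity
    {Ω : Type*} [MeasurableSpace Ω] {P : Measure Ω} {d : ℕ}
    {V : Ω → (Fin d → ℤ)} {U W : Ω → (Fin d → ℝ)} (hV : Measurable V) (hU : Measurable U)
    (hUdist : Measure.map U P = volume.restrict {x : Fin d → ℝ | ∀ i, 0 ≤ x i ∧ x i < 1})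
    (hind : IndepFun V U P) (hW : ∀ ω i, W ω i = (V ω i : ℝ) + U ω i) :
    Measure.map W P = volume.withDensity fun x => P (V ⁻¹' {intFloor d x}) := by
  have hWm : Measurable W := by
    refine measurable_pi_lambda _ fun i => ?_
    simp only [hW]
    exact ((measurable_of_countable fun n : ℤ => (n : ℝ)).comp
      ((measurable_pi_apply i).comp hV)).add ((measurable_pi_apply i).comp hU)
  ext s hs
  rw [Measure.map_apply hWm hs, withDensity_apply _ hs,
    setLIntegral_comp_intFloor (fun a => P (V ⁻¹' {a})) s]
  have hfib : W ⁻¹' s = ⋃ a, V ⁻¹' {a} ∩ U ⁻¹' (((fun i => (a i : ℝ)) + ·) ⁻¹' s) := by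
    ext ω
    have : W ω = (fun i => (V ω i : ℝ)) + U ω := funext (hW ω)
    simp [this]
  have hsm (a : Fin d → ℤ) : MeasurableSet (((fun i => (a i : ℝ)) + ·) ⁻¹' s) :=
    measurable_const_add _ hs
  rw [hfib, measure_iUnion]
  · refine tsum_congr fun a => ?_
    rw [hind.measure_inter_preimage_eq_mul _ _ (measurableSet_singleton a) (hsm a),
      ← Measure.map_apply hU (hsm a), hUdist, Measure.restrict_apply (hsm a),
      volume_inter_intFloor_fiber]
  · exact fun a b hab => Disjoint.mono Set.inter_subset_left Set.inter_subset_left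
      ((Set.disjoint_singleton.2 hab).preimage V)
  · exact fun a => (hV (measurableSet_singleton a)).inter (hU (hsm a))

/-- If `V` is ℤ^d-valued and `U` is uniform on `[0,1)^d`, independent of `V`, then
`V + U` has a density and its differential entropy (here an integral in `[0,∞]`,
since the density is bounded by 1) equals the discrete entropy `H(V)`. -/
theorem diffEnt_int_add_uniform_eq_discEnt
    {Ω : Type*} [MeasurableSpace Ω] (P : Measure Ω) [IsProbabilityMeasure P]
    (d : ℕ)
    (V : Ω → (Fin d → ℤ)) (U : Ω → (Fin d → ℝ))
    (hV : Measurable V) (hU : Measurable U)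
    (hUdist : Measure.map U P = volume.restrict {x : Fin d → ℝ | ∀ i, 0 ≤ x i ∧ x i < 1})
    (hind : IndepFun V U P) :
    ∀ W : Ω → (Fin d → ℝ), (∀ ω i, W ω i = (V ω i : ℝ) + U ω i) →
      Measure.map W P ≪ volume ∧
        ∫⁻ x, ENNReal.ofReal
            (Real.negMulLog (((Measure.map W P).rnDeriv volume x).toReal)) =
          discEnt P V := by
  intro W hW
  have hmap := map_int_add_uniform_eq_withDensity hV hU hUdist hind hW
  refine ⟨hmap ▸ withDensity_absolutelyContinuous _ _, ?_⟩
  have hm : Measurable fun x : Fin d → ℝ => P (V ⁻¹' {intFloor d x}) :=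
    (measurable_of_countable fun a => P (V ⁻¹' {a})).comp (measurable_intFloor d)
  rw [hmap, discEnt, ← lintegral_comp_intFloor]
  refine lintegral_congr_ae ?_
  filter_upwards [Measure.rnDeriv_withDensity volume hm] with x hx
  rw [hx]
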